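/- arXiv:1302.0347 — 2 statements merged into one kernel-verified Lean document; each statement's English description precedes it below -/
import Mathlib

section
/- Let n, l, v be natural numbers with l ≥ 1 and v = ⌈n/l⌉, let m be a list of l·v − n bits used as padding (denoted RBS), let m' be a list of n bits, and let σ be a permutation of {1, …, l}. Split the concatenation m' ∥ RBS (of length l·v) into l consecutive blocks b_1, …, b_l each of length v, and form the encoded string by concatenating the blocks in the order prescribed by σ. Then applying the inverse rearrangement prescribed by σ⁻¹ to the v-bit blocks of the encoded string and concatenating recovers m' ∥ RBS; in particular its first n bits equal m' and its last l·v − n bits equal RBS. (This is the correctness property PCA⁻¹(PCA(m, r, s), r, s) = m of the PCA encoding algorithm.) -/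
/-- In a concatenation of blocks of common length `v`, the `i`-th window of length `v` is the
`i`-th block. -/
theorem List.take_drop_flatten_ofFn {α : Type*} {v l : ℕ} (f : Fin l → List α)
    (hf : ∀ i, (f i).length = v) (i : Fin l) :
    ((List.ofFn f).flatten.drop (i.val * v)).take v = f i := by
  induction l with
  | zero => exact i.elim0
  | succ l ih =>
    rw [List.ofFn_succ, List.flatten_cons]
    cases i using Fin.cases with
    | zero => simp [List.take_left' (hf 0)]
    | succ i =>
      have h : (i.succ : ℕ) * v = (f 0).length + i.val * v := by
        rw [hf, Fin.val_succ, Nat.succ_mul, Nat.add_comm]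
      rw [h, List.drop_length_add_append]
      exact ih (fun i => f i.succ) (fun i => hf i.succ) i

/-- Cutting a list of length `l * v` into `l` consecutive windows of length `v` and concatenating
them gives back the list. -/
theorem List.flatten_ofFn_take_drop {α : Type*} {v l : ℕ} (xs : List α)
    (hxs : xs.length = l * v) :
    (List.ofFn fun i : Fin l => (xs.drop (i.val * v)).take v).flatten = xs := by
  induction l generalizing xs with
  | zero => simp_all
  | succ l ih =>
    have h := ih (xs.drop v) (by rw [List.length_drop, hxs, Nat.succ_mul, Nat.add_sub_cancel])
    simp only [List.drop_drop] at h
    simp only [List.ofFn_succ, List.flatten_cons, Fin.val_zero, Nat.zero_mul, List.drop_zero,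
      Fin.val_succ, Nat.succ_mul, Nat.add_comm _ v, h, List.take_append_drop]

/-- correctness of the PCA block-permutation encoding.
A message `m'` of `n` bits padded on the right with `RBS` (of length `l·v − n`,
where `v = ⌈n/l⌉`) is split into `l` consecutive blocks of length `v`; these are
concatenated in the order prescribed by a permutation `σ` of the `l` block
indices.  Taking the `v`-bit blocks of the encoded string, rearranging them by
`σ⁻¹` and concatenating recovers `m' ∥ RBS`; in particular the first `n` bits
are `m'` and the remaining `l·v − n` bits are `RBS`. -/
theorem stmt_4 (n l v : ℕ) (hl : 1 ≤ l) (hv : v = (n + l - 1) / l)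
    (m' rbs : List Bool) (hm : m'.length = n) (hrbs : rbs.length = l * v - n)
    (σ : Equiv.Perm (Fin l)) :
    let padded : List Bool := m' ++ rbs
    let b : Fin l → List Bool := fun i => (padded.drop (i.val * v)).take v
    let enc : List Bool := (List.ofFn fun i => b (σ i)).flatten
    let dec : List Bool :=
      (List.ofFn fun j : Fin l => (enc.drop ((σ.symm j).val * v)).take v).flatten
    dec = padded ∧ dec.take n = m' ∧ dec.drop n = rbs := by
  intro padded b enc dec
  have hn : n ≤ l * v := by
    have h₁ := Nat.div_add_mod (n + l - 1) l
    have h₂ := Nat.mod_lt (n + l - 1) hl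
    rw [← hv] at h₁
    omega
  have hpadded : padded.length = l * v := by
    simp only [padded, List.length_append, hm, hrbs]
    omega
  have hb : ∀ i, (b i).length = v := by
    intro i
    have h : (i.val + 1) * v ≤ l * v := Nat.mul_le_mul_right v i.isLt
    rw [Nat.succ_mul] at h
    simp only [b, List.length_take, List.length_drop, hpadded]
    omega
  have hdec : dec = padded := by
    have h : ∀ j : Fin l, (enc.drop ((σ.symm j).val * v)).take v = b j := fun j => by
      rw [List.take_drop_flatten_ofFn (fun i => b (σ i)) (fun i => hb (σ i)),
        Equiv.apply_symm_apply]
    simp only [dec, h]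
    exact List.flatten_ofFn_take_drop padded hpadded
  rw [hdec]
  exact ⟨rfl, List.take_left' hm, List.drop_left' hm⟩
end

section
/- Let h, r, r̄, z, y, i be natural numbers and let ŷ = y XOR 2^i (the value of y with its i-th binary digit flipped). Set C_1 = (h·y + r̄)·r + z and Ĉ_1 = (h·ŷ + r̄)·r + z. Then either Ĉ_1 = C_1 + 2^i·h·r (if the i-th bit of y is 0) or C_1 = Ĉ_1 + 2^i·h·r (if the i-th bit of y is 1); in particular, any single-bit modification of the encoded value y changes C_1 by exactly 2^i·h·r. -/
/-- Flipping a zero bit at position `i` adds `2 ^ i`. -/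
theorem Nat.xor_two_pow_of_testBit_eq_false {y i : ℕ} (hy : y.testBit i = false) :
    y ^^^ 2 ^ i = y + 2 ^ i := by
  induction i generalizing y with
  | zero =>
    have hdiv : (y ^^^ 1) / 2 = y / 2 := by simp [Nat.xor_div_two]
    have hmod : (y ^^^ 1) % 2 = (y + 1) % 2 := Nat.xor_mod_two_eq
    simp only [Nat.testBit_zero, decide_eq_false_iff_not] at hy
    rw [pow_zero]
    omega
  | succ i ih =>
    have hdiv : (y ^^^ 2 ^ (i + 1)) / 2 = y / 2 + 2 ^ i := by
      rw [Nat.xor_div_two, pow_succ, Nat.mul_div_cancel _ two_pos]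
      exact ih (by rwa [← Nat.testBit_succ])
    have hmod : (y ^^^ 2 ^ (i + 1)) % 2 = (y + 2 ^ (i + 1)) % 2 := Nat.xor_mod_two_eq
    rw [pow_succ] at *
    omega

/-- Flipping a one bit at position `i` subtracts `2 ^ i`. -/
theorem Nat.xor_two_pow_add_of_testBit_eq_true {y i : ℕ} (hy : y.testBit i = true) :
    (y ^^^ 2 ^ i) + 2 ^ i = y := by
  rw [← Nat.xor_two_pow_of_testBit_eq_false (by simp [hy]), Nat.xor_xor_cancel_right]

/-- with `ŷ = y XOR 2^i` (the `i`-th binary digit of `y` flipped),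
`C₁ = (h·y + r̄)·r + z` and `Ĉ₁ = (h·ŷ + r̄)·r + z`, either
`Ĉ₁ = C₁ + 2^i·h·r` (if the `i`-th bit of `y` is 0) or `C₁ = Ĉ₁ + 2^i·h·r`
(if the `i`-th bit of `y` is 1): any single-bit modification of `y` changes
`C₁` by exactly `2^i·h·r`. -/
theorem stmt_7 (h r rbar z y i : ℕ) :
    (y.testBit i = false →
      (h * (y ^^^ 2 ^ i) + rbar) * r + z = ((h * y + rbar) * r + z) + 2 ^ i * h * r) ∧
    (y.testBit i = true →
      (h * y + rbar) * r + z = ((h * (y ^^^ 2 ^ i) + rbar) * r + z) + 2 ^ i * h * r) := by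
  refine ⟨fun hy => ?_, fun hy => ?_⟩
  · rw [Nat.xor_two_pow_of_testBit_eq_false hy]
    ring
  · conv_lhs => rw [← Nat.xor_two_pow_add_of_testBit_eq_true hy]
    ring
end
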